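/- arXiv:1901.04708 — 4 statements merged into one kernel-verified Lean document; each statement's English description precedes it below -/
import Mathlib

section
/- Let P be a probability measure on ℝ × ℝ^p × ℝ^q with coordinates (t, x, z) such that: (i) for some B < ∞, ‖x‖ ≤ B and ‖z‖ ≤ B holds P-almost surely; (ii) ∫ t² dP(t,x,z) < ∞; and (iii) there is a constant D < ∞ such that for every θ in a fixed compact set Θ ⊂ ℝ^p × ℝ^q, the pushforward of P under the map (t,x,z) ↦ ε_θ(t,x,z) is absolutely continuous with respect to Lebesgue measure with density bounded by D. Fix τ ∈ ℝ. Then there exists a constant K₁ > 0 such that for every ε ∈ (0,1), the class of indicator functions F₀ = { (t,x,z) ↦ 1{ε_θ(t,x,z) ≥ s} : s ∈ (−∞,τ], θ ∈ Θ } admits an ε-bracketing in L₂(P) of cardinality at most K₁ ε^{−3(p+q+3/2)}. -/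
open MeasureTheory Set

lemma aux_exp (a a' Q d : ℝ) (ha : a ≤ Q) (ha' : a' ≤ Q) (h : |a - a'| ≤ d) :
    |Real.exp a - Real.exp a'| ≤ Real.exp Q * d := by
  have key : ∀ x y : ℝ, x ≤ Q → |x - y| ≤ d → Real.exp x - Real.exp y ≤ Real.exp Q * d := by
    intro x y hx hxy
    have h1 : Real.exp y = Real.exp x * Real.exp (y - x) := by
      rw [← Real.exp_add]; congr 1; ring
    have h2 := Real.add_one_le_exp (y - x)
    have h3 := Real.exp_le_exp.2 hx
    have h4 : 0 ≤ d := (abs_nonneg _).trans hxy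
    have h5 : x - y ≤ d := (le_abs_self _).trans hxy
    have h6 := Real.exp_pos x
    calc Real.exp x - Real.exp y ≤ Real.exp x * (x - y) := by rw [h1]; nlinarith
      _ ≤ Real.exp x * d := by gcongr
      _ ≤ Real.exp Q * d := by gcongr
  rw [abs_le]
  have := key a a' ha h
  have := key a' a ha' (by rwa [abs_sub_comm])
  constructor <;> linarith

lemma aux_lip (a a' v v' Q d d' V : ℝ) (ha : a ≤ Q) (ha' : a' ≤ Q) (h : |a - a'| ≤ d)
    (hv : |v| ≤ V) (hvv : |v - v'| ≤ d') :
    |Real.exp a * v - Real.exp a' * v'| ≤ Real.exp Q * (d * V + d') := by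
  have h1 := aux_exp a a' Q d ha ha' h
  have h2 : Real.exp a * v - Real.exp a' * v'
      = (Real.exp a - Real.exp a') * v + Real.exp a' * (v - v') := by ring
  rw [h2]
  have hd : 0 ≤ d := (abs_nonneg _).trans h
  calc _ ≤ |(Real.exp a - Real.exp a') * v| + |Real.exp a' * (v - v')| := abs_add_le _ _
    _ = |Real.exp a - Real.exp a'| * |v| + Real.exp a' * |v - v'| := by
        rw [abs_mul, abs_mul, abs_of_pos (Real.exp_pos a')]
    _ ≤ (Real.exp Q * d) * V + Real.exp Q * d' := by
        gcongr
    _ = _ := by ring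

lemma aux_coord {n : ℕ} (x : EuclideanSpace ℝ (Fin n)) (b : ℝ) (hx : ‖x‖ ≤ b) (i : Fin n) :
    |x i| ≤ b := by
  have := PiLp.norm_apply_le x i
  rw [Real.norm_eq_abs] at this
  linarith

lemma aux_sum {n : ℕ} (y : Fin n → ℝ) (x : EuclideanSpace ℝ (Fin n)) (r b : ℝ)
    (hx : ‖x‖ ≤ b) (hy : ∀ i, |y i| ≤ r) :
    |∑ i, y i * x i| ≤ n * (r * b) := by
  calc |∑ i, y i * x i| ≤ ∑ i, |y i * x i| := Finset.abs_sum_le_sum_abs _ _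
    _ ≤ ∑ _i : Fin n, r * b := by
        apply Finset.sum_le_sum
        intro i _
        rw [abs_mul]
        have h1 := aux_coord x b hx i
        have := hy i
        have h2 : 0 ≤ r := (abs_nonneg _).trans this
        gcongr
    _ = _ := by simp

lemma aux_bracket {Ω : Type*} [MeasurableSpace Ω] (P : Measure Ω) [IsProbabilityMeasure P]
    (f : Ω → ℝ) (hf : Measurable f) (A : Set Ω) (hA : MeasurableSet A) (a b e : ℝ) (hab : a ≤ b)
    (he : P.real Aᶜ + P.real (f ⁻¹' Ico a b) ≤ e) :
    ∃ l u : Ω → ℝ, Measurable l ∧ Measurable u ∧ (∀ o, l o ≤ u o) ∧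
      (∫ o, (u o - l o) ^ 2 ∂P ≤ e) ∧
      ∀ (s : ℝ) (g : Ω → ℝ), (∀ o ∈ A, b ≤ f o → s ≤ g o) → (∀ o ∈ A, s ≤ g o → a ≤ f o) →
        ∀ o, l o ≤ (if s ≤ g o then (1:ℝ) else 0) ∧ (if s ≤ g o then (1:ℝ) else 0) ≤ u o := by
  classical
  have m1 : MeasurableSet {o | o ∈ A ∧ b ≤ f o} := hA.inter (measurableSet_le measurable_const hf)
  have m2 : MeasurableSet {o | o ∈ A ∧ f o < a} := hA.inter (measurableSet_lt hf measurable_const)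
  have m3 : MeasurableSet (f ⁻¹' Ico a b) := hf measurableSet_Ico
  refine ⟨fun o => if o ∈ A ∧ b ≤ f o then 1 else 0, fun o => if o ∈ A ∧ f o < a then 0 else 1,
    Measurable.ite m1 measurable_const measurable_const,
    Measurable.ite m2 measurable_const measurable_const, ?_, ?_, ?_⟩
  · intro o
    dsimp only
    split_ifs with h1 h2 <;> try norm_num
    linarith [h1.2, h2.2]
  · refine le_trans ?_ he
    rw [← integral_indicator_one hA.compl, ← integral_indicator_one m3, ← integral_add]
    · apply integral_mono_of_nonneg
      · exact Filter.Eventually.of_forall fun o => sq_nonneg _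
      · exact ((integrable_const (1:ℝ)).indicator hA.compl).add
          ((integrable_const (1:ℝ)).indicator m3)
      · refine Filter.Eventually.of_forall fun o => ?_
        simp only [indicator, mem_compl_iff, mem_preimage, mem_Ico, Pi.one_apply, Pi.add_apply]
        by_cases h1 : o ∈ A <;> by_cases h2 : a ≤ f o <;> by_cases h3 : b ≤ f o <;>
          simp [h1, h2, h3, not_lt.2, not_le.1] <;> grind
    · exact ((integrable_const (1:ℝ)).indicator hA.compl)
    · exact ((integrable_const (1:ℝ)).indicator m3)
  · intro s g h1 h2 o
    dsimp only
    have := h1 o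
    have := h2 o
    constructor <;> split_ifs <;> first | (norm_num; done) | grind

lemma aux_density {Ω : Type*} [MeasurableSpace Ω] (P : Measure Ω) [IsProbabilityMeasure P]
    (f : Ω → ℝ) (hf : Measurable f) (g : ℝ → ℝ) (D a b : ℝ) (hD : 0 ≤ D) (hab : a ≤ b)
    (hg : ∀ u, g u ≤ D)
    (hm : P.map f = volume.withDensity (fun u => ENNReal.ofReal (g u))) :
    P.real (f ⁻¹' Ico a b) ≤ D * (b - a) := by
  have h : P (f ⁻¹' Ico a b) ≤ ENNReal.ofReal (D * (b - a)) := by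
    rw [← Measure.map_apply hf measurableSet_Ico, hm, withDensity_apply _ measurableSet_Ico]
    calc _ ≤ ∫⁻ _u in Ico a b, ENNReal.ofReal D :=
          lintegral_mono fun u => ENNReal.ofReal_le_ofReal (hg u)
      _ = _ := by
        simp [ENNReal.ofReal_mul hD]
  exact ENNReal.toReal_le_of_le_ofReal (mul_nonneg hD (by linarith)) h

lemma aux_tail {Ω : Type*} [MeasurableSpace Ω] (P : Measure Ω) [IsProbabilityMeasure P]
    (f : Ω → ℝ) (hT : Integrable (fun o => f o ^ 2) P) (T : ℝ) (hT0 : 0 < T) :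
    P.real {o | T < |f o|} ≤ (∫ o, f o ^ 2 ∂P) / T ^ 2 := by
  have h := mul_meas_ge_le_integral_of_nonneg (μ := P) (f := fun o => f o ^ 2)
    (Filter.Eventually.of_forall fun o => sq_nonneg _) hT (T ^ 2)
  rw [le_div_iff₀ (by positivity), mul_comm]
  refine le_trans ?_ h
  refine mul_le_mul_of_nonneg_left (measureReal_mono ?_) (by positivity)
  intro o ho
  simp only [mem_setOf_eq] at *
  rw [← sq_abs (f o)]
  gcongr

lemma aux_floor (x y δ : ℝ) (hδ : 0 < δ) (hx : 0 ≤ x) (hy : 0 ≤ y)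
    (h : ⌊x / δ⌋₊ = ⌊y / δ⌋₊) : |x - y| ≤ δ := by
  have a1 := Nat.floor_le (div_nonneg hx hδ.le)
  have a2 := Nat.lt_floor_add_one (x / δ)
  have b1 := Nat.floor_le (div_nonneg hy hδ.le)
  have b2 := Nat.lt_floor_add_one (y / δ)
  rw [h] at a1 a2
  rw [le_div_iff₀ hδ] at a1 b1
  rw [div_lt_iff₀ hδ] at a2 b2
  rw [abs_le]
  constructor <;> nlinarith

set_option maxHeartbeats 2000000 in
/-- Bracketing-number bound for the indicator class
`F₀ = { o ↦ 1{ε_θ(o) ≥ s} : s ∈ (−∞,τ], θ ∈ Θ }`. -/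
theorem stmt_0
    (p q : ℕ)
    (P : Measure (ℝ × EuclideanSpace ℝ (Fin p) × EuclideanSpace ℝ (Fin q)))
    [IsProbabilityMeasure P]
    (Θ : Set (EuclideanSpace ℝ (Fin p) × EuclideanSpace ℝ (Fin q)))
    (hΘ : IsCompact Θ)
    (B : ℝ)
    (hB : ∀ᵐ o ∂P, ‖o.2.1‖ ≤ B ∧ ‖o.2.2‖ ≤ B)
    (hT : Integrable (fun o => o.1 ^ 2) P)
    (eps : (EuclideanSpace ℝ (Fin p) × EuclideanSpace ℝ (Fin q)) →
      (ℝ × EuclideanSpace ℝ (Fin p) × EuclideanSpace ℝ (Fin q)) → ℝ)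
    (heps : ∀ θ o, eps θ o =
      Real.exp (∑ i, θ.2 i * o.2.2 i) * (o.1 + ∑ i, θ.1 i * o.2.1 i))
    (D : ℝ)
    (hD : ∀ θ ∈ Θ, ∃ g : ℝ → ℝ, (∀ u, 0 ≤ g u ∧ g u ≤ D) ∧
      P.map (eps θ) = volume.withDensity (fun u => ENNReal.ofReal (g u)))
    (τ : ℝ) :
    ∃ K₁ : ℝ, 0 < K₁ ∧ ∀ ε ∈ Ioo (0:ℝ) 1,
      ∃ (N : ℕ) (l u : Fin N →
        (ℝ × EuclideanSpace ℝ (Fin p) × EuclideanSpace ℝ (Fin q)) → ℝ),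
        (N : ℝ) ≤ K₁ * ε ^ (-(3 * ((p : ℝ) + q + 3 / 2))) ∧
        (∀ k, Measurable (l k) ∧ Measurable (u k)) ∧
        (∀ k o, l k o ≤ u k o) ∧
        (∀ k, ∫ o, (u k o - l k o) ^ 2 ∂P ≤ ε ^ 2) ∧
        (∀ s ≤ τ, ∀ θ ∈ Θ, ∃ k, ∀ o,
          l k o ≤ (if s ≤ eps θ o then (1:ℝ) else 0) ∧
          (if s ≤ eps θ o then (1:ℝ) else 0) ≤ u k o) := by
  classical
  -- constants
  obtain ⟨b, hb0, hb⟩ : ∃ b : ℝ, 0 ≤ b ∧ ∀ᵐ o ∂P, ‖o.2.1‖ ≤ b ∧ ‖o.2.2‖ ≤ b :=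
    ⟨|B|, abs_nonneg _, hB.mono fun o ho => ⟨ho.1.trans (le_abs_self _), ho.2.trans (le_abs_self _)⟩⟩
  obtain ⟨R, hR0, hR⟩ : ∃ R : ℝ, 0 ≤ R ∧ ∀ θ ∈ Θ, (∀ i, |θ.1 i| ≤ R) ∧ (∀ i, |θ.2 i| ≤ R) := by
    obtain ⟨R, hR⟩ := hΘ.isBounded.exists_norm_le
    refine ⟨|R|, abs_nonneg _, fun θ hθ => ⟨fun i => ?_, fun i => ?_⟩⟩
    · exact aux_coord _ _ (((norm_fst_le θ).trans (hR θ hθ)).trans (le_abs_self _)) i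
    · exact aux_coord _ _ (((norm_snd_le θ).trans (hR θ hθ)).trans (le_abs_self _)) i
  obtain ⟨E, hE1, hE⟩ : ∃ E : ℝ, 0 < E ∧ ∀ θ ∈ Θ, ∃ g : ℝ → ℝ, (∀ u, g u ≤ E) ∧
      P.map (eps θ) = volume.withDensity (fun u => ENNReal.ofReal (g u)) := by
    refine ⟨|D| + 1, by positivity, fun θ hθ => ?_⟩
    obtain ⟨g, hg, hm⟩ := hD θ hθ
    exact ⟨g, fun u => by linarith [(hg u).2, le_abs_self D], hm⟩
  have hmeas : ∀ θ, Measurable (eps θ) := by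
    intro θ
    have : eps θ = fun o => Real.exp (∑ i, θ.2 i * o.2.2 i) * (o.1 + ∑ i, θ.1 i * o.2.1 i) :=
      funext (heps θ)
    rw [this]
    apply Continuous.measurable
    fun_prop
  set M2 : ℝ := ∫ o, o.1 ^ 2 ∂P with hM2
  have hM20 : 0 ≤ M2 := integral_nonneg fun o => sq_nonneg _
  obtain ⟨a, ha1, ha2⟩ : ∃ a : ℝ, 1 ≤ a ∧ 2 * M2 ≤ a ^ 2 := ⟨2 * M2 + 1, by linarith, by nlinarith⟩
  set Q : ℝ := q * (R * b) with hQ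
  have hQ0 : 0 ≤ Q := by positivity
  set V : ℝ := p * (R * b) with hV
  have hV0 : 0 ≤ V := by positivity
  set C0 : ℝ := Real.exp Q * (q * b * (1 + V) + p * b) + 1 with hC0
  have hC00 : 1 ≤ C0 := by
    rw [hC0]; have : 0 ≤ Real.exp Q * (q * b * (1 + V) + p * b) := by positivity
    linarith
  set C1 : ℝ := Real.exp Q * (1 + V) with hC1
  have hC10 : 0 ≤ C1 := by positivity
  have hEps : ∀ T : ℝ, 1 ≤ T → ∀ δ : ℝ, 0 ≤ δ → ∀ o : ℝ × EuclideanSpace ℝ (Fin p) × EuclideanSpace ℝ (Fin q),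
      |o.1| ≤ T → ‖o.2.1‖ ≤ b → ‖o.2.2‖ ≤ b → ∀ θ ∈ Θ, ∀ θ' ∈ Θ,
      (∀ i, |θ.1 i - θ'.1 i| ≤ δ) → (∀ i, |θ.2 i - θ'.2 i| ≤ δ) →
      |eps θ o - eps θ' o| ≤ C0 * (δ * T) := by
    intro T hT1 δ hδ o ho hx hz θ hθ θ' hθ' h1 h2
    have e1 := aux_sum _ o.2.2 R b hz (hR θ hθ).2
    have e2 := aux_sum _ o.2.2 R b hz (hR θ' hθ').2
    have e3 := aux_sum _ o.2.1 R b hx (hR θ hθ).1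
    have e4 := aux_sum (fun i => θ.1 i - θ'.1 i) o.2.1 δ b hx h1
    have e5 := aux_sum (fun i => θ.2 i - θ'.2 i) o.2.2 δ b hz h2
    simp only [sub_mul, Finset.sum_sub_distrib] at e4 e5
    rw [heps, heps]
    refine (aux_lip _ _ _ _ Q (q * (δ * b)) (p * (δ * b)) (T + V) ((le_abs_self _).trans e1)
      ((le_abs_self _).trans e2) e5 ((abs_add_le _ _).trans (add_le_add ho e3)) ?_).trans ?_
    · rwa [add_sub_add_left_eq_sub]
    · rw [hC0]
      have : q * (δ * b) * (T + V) + p * (δ * b) ≤ (q * b * (1 + V) + p * b) * (δ * T) := by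
        have i1 : 0 ≤ (q:ℝ) * b * δ := by positivity
        have i2 : 0 ≤ (p:ℝ) * b * δ := by positivity
        have i3 : 0 ≤ (T - 1) := by linarith
        nlinarith [mul_nonneg i2 i3, mul_nonneg (mul_nonneg i1 i3) hV0]
      have h3 : 0 ≤ δ * T := by positivity
      have := mul_le_mul_of_nonneg_left this (Real.exp_pos Q).le
      linarith
  have hLow : ∀ T : ℝ, 1 ≤ T → ∀ o : ℝ × EuclideanSpace ℝ (Fin p) × EuclideanSpace ℝ (Fin q),
      |o.1| ≤ T → ‖o.2.1‖ ≤ b → ‖o.2.2‖ ≤ b → ∀ θ ∈ Θ, -(C1 * T) ≤ eps θ o := by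
    intro T hT1 o ho hx hz θ hθ
    have e1 := aux_sum _ o.2.2 R b hz (hR θ hθ).2
    have e3 := aux_sum _ o.2.1 R b hx (hR θ hθ).1
    rw [heps]
    have e4 : Real.exp (∑ i, θ.2 i * o.2.2 i) ≤ Real.exp Q :=
      Real.exp_le_exp.2 ((le_abs_self _).trans e1)
    have e5 : -(T + V) ≤ o.1 + ∑ i, θ.1 i * o.2.1 i := by
      have := neg_abs_le (∑ i, θ.1 i * o.2.1 i)
      have := neg_abs_le o.1
      linarith
    have e6 := Real.exp_pos (∑ i, θ.2 i * o.2.2 i)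
    calc -(C1 * T) ≤ -(Real.exp Q * (T + V)) := by
          rw [hC1, neg_le_neg_iff, mul_assoc]
          gcongr
          nlinarith
      _ ≤ -(Real.exp (∑ i, θ.2 i * o.2.2 i) * (T + V)) := by
          gcongr
      _ = Real.exp (∑ i, θ.2 i * o.2.2 i) * (-(T + V)) := by ring
      _ ≤ _ := by gcongr
  -- counting constants
  set KM : ℝ := 2 * R * (8 * E * C0 * a) + 1 with hKM
  have hKM0 : 0 < KM := by positivity
  set KL : ℝ := (|τ| + C1 * a) * (4 * E) + 1 with hKL
  have hKL0 : 0 < KL := by positivity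
  refine ⟨KM ^ p * (KM ^ q * KL), by positivity, ?_⟩
  rintro ε ⟨hε0, hε1⟩
  set T : ℝ := a / ε with hTdef
  have hT1 : 1 ≤ T := by rw [hTdef, le_div_iff₀ hε0]; linarith
  set δ : ℝ := ε ^ 3 / (8 * E * C0 * a) with hδdef
  have hδ : 0 < δ := by positivity
  set h : ℝ := ε ^ 2 / (4 * E) with hhdef
  have hh : 0 < h := by positivity
  set S : ℝ := C1 * T with hS
  have hS0 : 0 ≤ S := by positivity
  set κ : ℝ := C0 * (δ * T) with hκ
  have hκ0 : 0 ≤ κ := by positivity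
  have hκe : κ = ε ^ 2 / (8 * E) := by
    rw [hκ, hδdef, hTdef]; field_simp
  set M : ℕ := ⌊2 * R / δ⌋₊ + 1 with hM
  set L : ℕ := ⌊(|τ| + S) / h⌋₊ + 1 with hL
  have hMle : (M : ℝ) ≤ KM * (ε ^ 3)⁻¹ := by
    have h1 : (M : ℝ) ≤ 2 * R / δ + 1 := by
      rw [hM]; push_cast
      have := Nat.floor_le (show 0 ≤ 2 * R / δ by positivity)
      linarith
    have h2 : 2 * R / δ = 2 * R * (8 * E * C0 * a) * (ε ^ 3)⁻¹ := by
      rw [hδdef]; field_simp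
    have h3 : 1 ≤ (ε ^ 3)⁻¹ := one_le_inv₀ (by positivity) |>.2 (pow_le_one₀ hε0.le hε1.le)
    rw [hKM, add_mul, ← h2]; linarith
  have hLle : (L : ℝ) ≤ KL * (ε ^ 3)⁻¹ := by
    have h1 : (L : ℝ) ≤ (|τ| + S) / h + 1 := by
      rw [hL]; push_cast
      have := Nat.floor_le (show 0 ≤ (|τ| + S) / h by positivity)
      linarith
    have h2 : (|τ| + S) / h ≤ (|τ| + C1 * a) * (4 * E) * (ε ^ 3)⁻¹ := by
      have : (|τ| + C1 * a) * (4 * E) * (ε ^ 3)⁻¹ = (|τ| / ε + S) / h := by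
        rw [hS, hhdef, hTdef]; field_simp
      rw [this]
      gcongr
      rw [le_div_iff₀ hε0]
      nlinarith [abs_nonneg τ]
    have h3 : 1 ≤ (ε ^ 3)⁻¹ := one_le_inv₀ (by positivity) |>.2 (pow_le_one₀ hε0.le hε1.le)
    rw [hKL, add_mul]; linarith
  -- the good set
  set A : Set (ℝ × EuclideanSpace ℝ (Fin p) × EuclideanSpace ℝ (Fin q)) :=
    {o | |o.1| ≤ T ∧ ‖o.2.1‖ ≤ b ∧ ‖o.2.2‖ ≤ b} with hA
  have hAm : MeasurableSet A := by
    have c1 : IsClosed {o : ℝ × EuclideanSpace ℝ (Fin p) × EuclideanSpace ℝ (Fin q) | |o.1| ≤ T} :=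
      isClosed_le (by fun_prop) continuous_const
    have c2 : IsClosed {o : ℝ × EuclideanSpace ℝ (Fin p) × EuclideanSpace ℝ (Fin q) | ‖o.2.1‖ ≤ b} :=
      isClosed_le (by fun_prop) continuous_const
    have c3 : IsClosed {o : ℝ × EuclideanSpace ℝ (Fin p) × EuclideanSpace ℝ (Fin q) | ‖o.2.2‖ ≤ b} :=
      isClosed_le (by fun_prop) continuous_const
    exact (c1.inter (c2.inter c3)).measurableSet
  have hAc : P.real Aᶜ ≤ ε ^ 2 / 2 := by
    have h1 : P.real Aᶜ ≤ P.real {o | T < |o.1|} := by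
      apply ENNReal.toReal_mono (measure_ne_top _ _)
      apply measure_mono_ae
      filter_upwards [hb] with o ho hoA
      by_contra hc
      exact hoA ⟨not_lt.1 hc, ho⟩
    refine (h1.trans (aux_tail P (fun o => o.1) hT T (by linarith))).trans ?_
    rw [div_le_iff₀ (by positivity), ← hM2, hTdef]
    have : ε ^ 2 / 2 * (a / ε) ^ 2 = a ^ 2 / 2 := by field_simp
    rw [this]; linarith
  -- brackets for each cell
  have hcell : ∀ c : (Fin p → Fin M) × (Fin q → Fin M) × Fin L,
      ∃ l u : (ℝ × EuclideanSpace ℝ (Fin p) × EuclideanSpace ℝ (Fin q)) → ℝ,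
        Measurable l ∧ Measurable u ∧ (∀ o, l o ≤ u o) ∧ (∫ o, (u o - l o) ^ 2 ∂P ≤ ε ^ 2) ∧
        ∀ s ≤ τ, ∀ θ ∈ Θ, (∀ i, ⌊(θ.1 i + R) / δ⌋₊ = (c.1 i : ℕ)) →
          (∀ i, ⌊(θ.2 i + R) / δ⌋₊ = (c.2.1 i : ℕ)) →
          ⌊(max s (-S) + S) / h⌋₊ = (c.2.2 : ℕ) → ∀ o,
          l o ≤ (if s ≤ eps θ o then (1:ℝ) else 0) ∧
          (if s ≤ eps θ o then (1:ℝ) else 0) ≤ u o := by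
    intro c
    by_cases hc : ∃ θ ∈ Θ, (∀ i, ⌊(θ.1 i + R) / δ⌋₊ = (c.1 i : ℕ)) ∧
          (∀ i, ⌊(θ.2 i + R) / δ⌋₊ = (c.2.1 i : ℕ))
    swap
    · refine ⟨fun _ => 0, fun _ => 0, measurable_const, measurable_const, fun _ => le_rfl, ?_, ?_⟩
      · simp; positivity
      · intro s hs θ hθ h1 h2
        exact absurd ⟨θ, hθ, h1, h2⟩ hc
    obtain ⟨θ', hθ', k1, k2⟩ := hc
    obtain ⟨g, hg, hm⟩ := hE θ' hθ'
    set sj : ℝ := -S + (c.2.2 : ℕ) * h with hsj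
    have hden := aux_density P (eps θ') (hmeas θ') g E (sj - κ) (sj + h + κ) hE1.le
      (by linarith) hg hm
    have hsum : P.real Aᶜ + P.real (eps θ' ⁻¹' Ico (sj - κ) (sj + h + κ)) ≤ ε ^ 2 := by
      have : E * (sj + h + κ - (sj - κ)) = ε ^ 2 / 2 := by
        rw [hκe, hhdef]; field_simp; ring
      linarith
    obtain ⟨l, u, hl, hu, hlu, hint, hbr⟩ := aux_bracket P (eps θ') (hmeas θ') A hAm (sj - κ)
      (sj + h + κ) (ε ^ 2) (by linarith) hsum
    refine ⟨l, u, hl, hu, hlu, hint, ?_⟩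
    intro s hs θ hθ h1 h2 h3
    have hpos : ∀ x : ℝ, |x| ≤ R → 0 ≤ x + R := fun x hx => by
      have := neg_abs_le x; linarith
    have d1 : ∀ i, |θ.1 i - θ'.1 i| ≤ δ := fun i => by
      have := aux_floor (θ.1 i + R) (θ'.1 i + R) δ hδ (hpos _ ((hR θ hθ).1 i))
        (hpos _ ((hR θ' hθ').1 i)) ((h1 i).trans (k1 i).symm)
      rwa [add_sub_add_right_eq_sub] at this
    have d2 : ∀ i, |θ.2 i - θ'.2 i| ≤ δ := fun i => by
      have := aux_floor (θ.2 i + R) (θ'.2 i + R) δ hδ (hpos _ ((hR θ hθ).2 i))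
        (hpos _ ((hR θ' hθ').2 i)) ((h2 i).trans (k2 i).symm)
      rwa [add_sub_add_right_eq_sub] at this
    have hms : 0 ≤ max s (-S) + S := by have := le_max_right s (-S); linarith
    have f1 := Nat.floor_le (div_nonneg hms hh.le)
    have f2 := Nat.lt_floor_add_one ((max s (-S) + S) / h)
    rw [h3] at f1 f2
    rw [le_div_iff₀ hh] at f1
    rw [div_lt_iff₀ hh, add_mul, one_mul] at f2
    apply hbr
    · intro o ho hle
      have := abs_le.1 (hEps T hT1 δ hδ.le o ho.1 ho.2.1 ho.2.2 θ hθ θ' hθ' d1 d2)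
      have h5 := le_max_left s (-S)
      linarith [this.1]
    · intro o ho hle
      have := abs_le.1 (hEps T hT1 δ hδ.le o ho.1 ho.2.1 ho.2.2 θ hθ θ' hθ' d1 d2)
      have h5 := max_le hle (hLow T hT1 o ho.1 ho.2.1 ho.2.2 θ hθ)
      linarith [this.2]
  choose l u hl hu hlu hint hcov using hcell
  let I := (Fin p → Fin M) × (Fin q → Fin M) × Fin L
  let e : I ≃ Fin (Fintype.card I) := Fintype.equivFin I
  refine ⟨Fintype.card I, fun k => l (e.symm k), fun k => u (e.symm k), ?_,
    fun k => ⟨hl _, hu _⟩, fun k => hlu _, fun k => hint _, ?_⟩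
  · have hcard : (Fintype.card I : ℝ) = (M:ℝ) ^ p * ((M:ℝ) ^ q * L) := by
      simp [I, Fintype.card_prod]
    rw [hcard]
    calc (M:ℝ) ^ p * ((M:ℝ) ^ q * L)
        ≤ (KM * (ε ^ 3)⁻¹) ^ p * ((KM * (ε ^ 3)⁻¹) ^ q * (KL * (ε ^ 3)⁻¹)) := by gcongr
      _ = KM ^ p * (KM ^ q * KL) * ((ε ^ (3 * (p + q + 1)))⁻¹) := by
          rw [mul_pow, mul_pow, pow_mul, pow_add, pow_add, mul_inv, mul_inv]
          simp only [inv_pow, pow_one]; ring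
      _ ≤ _ := by
          gcongr
          rw [← Real.rpow_natCast, ← Real.rpow_neg hε0.le]
          apply Real.rpow_le_rpow_of_exponent_ge hε0 hε1.le
          push_cast; linarith
  · intro s hs θ hθ
    have hlt : ∀ x : ℝ, |x| ≤ R → ⌊(x + R) / δ⌋₊ < M := fun x hx => by
      rw [hM, Nat.lt_succ_iff]
      apply Nat.floor_mono
      gcongr
      have := le_abs_self x; linarith
    have hlt' : ⌊(max s (-S) + S) / h⌋₊ < L := by
      rw [hL, Nat.lt_succ_iff]
      apply Nat.floor_mono
      gcongr
      exact max_le (hs.trans (le_abs_self _)) (by have := abs_nonneg τ; linarith)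
    refine ⟨e (fun i => ⟨_, hlt _ ((hR θ hθ).1 i)⟩, fun i => ⟨_, hlt _ ((hR θ hθ).2 i)⟩,
      ⟨_, hlt'⟩), ?_⟩
    simp only [Equiv.symm_apply_apply]
    exact hcov _ s hs θ hθ (fun i => rfl) (fun i => rfl) rfl
end

section
/- Let P be a probability measure on ℝ × ℝ^p × ℝ^q with coordinates (t, x, z) such that: (i) for some B < ∞, ‖x‖ ≤ B and ‖z‖ ≤ B holds P-almost surely; (ii) ∫ t² dP(t,x,z) < ∞; and (iii) there is a constant D < ∞ such that for every θ in a fixed compact set Θ ⊂ ℝ^p × ℝ^q, the pushforward of P under the map (t,x,z) ↦ ε_θ(t,x,z) is absolutely continuous with respect to Lebesgue measure with density bounded by D. Fix τ ∈ ℝ. Then there exists a constant K₂ > 0 such that for every ε ∈ (0,1), the class of ℝ^{p+q}-valued functions F₁ = { (t,x,z) ↦ 1{ε_θ(t,x,z) ≥ s} · (exp(γᵀz) xᵀ, zᵀ) : s ∈ (−∞,τ], θ ∈ Θ } admits an ε-bracketing in L₂(P) of cardinality at most K₂ ε^{−(6p+7q+9)}. -/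
open MeasureTheory Set

lemma aux_cover {X κ : Type*} [Fintype κ] (S : Set X) (ψ : X → κ → ℝ) (b : κ → ℝ)
    (η : ℝ) (hη : 0 < η) (hb : ∀ x ∈ S, ∀ i, |ψ x i| ≤ b i) (hb0 : ∀ i, 0 ≤ b i) :
    ∃ (N : ℕ) (r : Fin N → X), (N : ℝ) ≤ ∏ i, (2 * b i / η + 2) ∧ (∀ k, r k ∈ S) ∧
      ∀ x ∈ S, ∃ k, ∀ i, |ψ x i - ψ (r k) i| ≤ η := by
  classical
  let f : X → κ → ℤ := fun x i => ⌊ψ x i / η⌋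
  let Q : Finset (κ → ℤ) := Fintype.piFinset (fun i => Finset.Icc ⌊-(b i) / η⌋ ⌊b i / η⌋)
  let Q' : Finset (κ → ℤ) := Q.filter (fun g => ∃ x ∈ S, f x = g)
  have hQ' : ∀ g : Q', ∃ x ∈ S, f x = g := fun g => (Finset.mem_filter.1 g.2).2
  choose rep hrepS hrepf using hQ'
  refine ⟨Q'.card, fun k => rep (Q'.equivFin.symm k), ?_, fun k => hrepS _, ?_⟩
  · have h1 : Q'.card ≤ Q.card := Finset.card_filter_le _ _
    have h2 : (Q.card : ℝ) ≤ ∏ i, (2 * b i / η + 2) := by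
      simp only [Q, Fintype.card_piFinset, Int.card_Icc]
      push_cast
      refine Finset.prod_le_prod (fun i _ => by positivity) (fun i _ => ?_)
      have a1 := Int.floor_le (b i / η)
      have a2 := Int.lt_floor_add_one (-(b i) / η)
      have a3 : -(b i) / η = - (b i / η) := by ring
      have a4 : 0 ≤ b i / η := div_nonneg (hb0 i) hη.le
      have a5 : 2 * b i / η = 2 * (b i / η) := by ring
      have h3 : (((⌊b i / η⌋ + 1 - ⌊-(b i) / η⌋).toNat : ℤ) : ℝ) ≤ 2 * b i / η + 2 := by
        rw [Int.toNat_eq_max]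
        push_cast
        rw [a3] at a2 ⊢
        apply max_le
        · linarith
        · linarith
      exact_mod_cast h3
    exact le_trans (by exact_mod_cast h1) h2
  · intro x hx
    have hm : f x ∈ Q' := by
      refine Finset.mem_filter.2 ⟨?_, x, hx, rfl⟩
      refine Fintype.mem_piFinset.2 (fun i => Finset.mem_Icc.2 ?_)
      have := abs_le.1 (hb x hx i)
      exact ⟨Int.floor_le_floor (by gcongr; exact this.1), Int.floor_le_floor (by gcongr; exact this.2)⟩
    refine ⟨Q'.equivFin ⟨f x, hm⟩, fun i => ?_⟩
    have h := congrFun (hrepf ⟨f x, hm⟩) i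
    simp only [Equiv.symm_apply_apply]
    have h' := (Int.abs_sub_lt_one_of_floor_eq_floor h).le
    rw [← sub_div, abs_div, abs_of_pos hη, div_le_one hη, abs_sub_comm] at h'
    exact h'

lemma aux_bracket_s1 {Ω ι κ Par : Type*} [MeasurableSpace Ω] (P : Measure Ω)
    [IsProbabilityMeasure P] (Θ : Set Par) (φ : Par → κ → ℝ)
    (t : Ω → ℝ) (ht : Measurable t) (ht2 : Integrable (fun o => t o ^ 2) P)
    (e : Par → Ω → ℝ) (he : ∀ θ, Measurable (e θ))
    (V : Par → Ω → ι → ℝ) (hV : ∀ θ i, Measurable (fun o => V θ o i))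
    (G : Set Ω) (hG : MeasurableSet G) (hPG : ∀ᵐ o ∂P, o ∈ G)
    (env : Ω → ℝ) (henv : Measurable env) (hVe : ∀ θ ∈ Θ, ∀ o i, |V θ o i| ≤ env o)
    (henv0 : ∀ o, 0 ≤ env o)
    (C : ℝ) (hC : 1 ≤ C) (henvC : ∀ o ∈ G, env o ≤ C)
    (heC : ∀ θ ∈ Θ, ∀ o ∈ G, |e θ o| ≤ C * (1 + |t o|))
    (hed : ∀ η > 0, ∀ θ ∈ Θ, ∀ θ' ∈ Θ, (∀ i, |φ θ i - φ θ' i| ≤ η) →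
      ∀ o ∈ G, |e θ o - e θ' o| ≤ C * η * (1 + |t o|))
    (hVd : ∀ η > 0, ∀ θ ∈ Θ, ∀ θ' ∈ Θ, (∀ i, |φ θ i - φ θ' i| ≤ η) →
      ∀ o ∈ G, ∀ i, |V θ o i - V θ' o i| ≤ C * η)
    (D : ℝ) (hD : ∀ θ ∈ Θ, ∀ s r : ℝ, 0 ≤ r → P.real {o | |e θ o - s| ≤ r} ≤ 2 * D * r)
    (δ : ℝ) (hδ : δ ∈ Ioo (0:ℝ) 1) (θ₀ : Par) (hθ₀ : θ₀ ∈ Θ) (s₀ : ℝ) :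
    ∃ (c : Ω → ι → ℝ) (h : Ω → ℝ), (∀ i, Measurable (fun o => c o i)) ∧ Measurable h ∧
      (∀ o, 0 ≤ h o) ∧
      ∫ o, h o ^ 2 ∂P ≤ (C^2 + 4 * C^2 * ((∫ o, t o ^ 2 ∂P) + 2 * D * (2 * C + 1))) * δ ^ 2 ∧
      ∀ θ ∈ Θ, ∀ s, (∀ i, |φ θ i - φ θ₀ i| ≤ δ ^ 3) →
        |max s (-(C * (1 + 1 / δ))) - s₀| ≤ δ ^ 3 →
        ∀ o i, |(if s ≤ e θ o then (1:ℝ) else 0) * V θ o i - c o i| ≤ h o := by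
  classical
  obtain ⟨hδ0, hδ1⟩ := hδ
  set bad : Set Ω := {o | 1 / δ ^ 2 ≤ t o ^ 2} ∪ {o | |e θ₀ o - s₀| ≤ (2 * C + 1) * δ ^ 2} with hbad
  have hbm : MeasurableSet bad := by
    apply MeasurableSet.union
    · exact measurableSet_le measurable_const (ht.pow_const 2)
    · exact measurableSet_le (by have := he θ₀; fun_prop) measurable_const
  have hPbad : P.real bad ≤ ((∫ o, t o ^ 2 ∂P) + 2 * D * (2 * C + 1)) * δ ^ 2 := by
    have h1 := mul_meas_ge_le_integral_of_nonneg (μ := P) (f := fun o => t o ^ 2)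
      (Filter.Eventually.of_forall fun o => sq_nonneg _) ht2 (1 / δ ^ 2)
    have h2 := hD θ₀ hθ₀ s₀ ((2 * C + 1) * δ ^ 2) (by positivity)
    have h3 := measureReal_union_le (μ := P) {o | 1 / δ ^ 2 ≤ t o ^ 2}
      {o | |e θ₀ o - s₀| ≤ (2 * C + 1) * δ ^ 2}
    rw [div_mul_eq_mul_div, one_mul, div_le_iff₀ (by positivity)] at h1
    have h4 : P.real {o | 1 / δ ^ 2 ≤ t o ^ 2} ≤ (∫ o, t o ^ 2 ∂P) * δ ^ 2 := h1
    rw [hbad]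
    linarith
  set nice : Set Ω := G \ bad
  have hnm : MeasurableSet nice := hG.diff hbm
  refine ⟨fun o i => (if s₀ ≤ e θ₀ o then (1:ℝ) else 0) * V θ₀ o i,
    fun o => if o ∈ nice then C * δ ^ 3 else 2 * env o, ?_, ?_, ?_, ?_, ?_⟩
  · intro i
    exact (Measurable.ite (measurableSet_le measurable_const (he θ₀)) measurable_const
      measurable_const).mul (hV θ₀ i)
  · exact Measurable.ite hnm measurable_const (henv.const_mul 2)
  · intro o
    dsimp only
    split_ifs
    · positivity
    · have := henv0 o; positivity
  · have hi : Integrable (fun o => C ^ 2 * δ ^ 2 + bad.indicator (fun _ => 4 * C ^ 2) o) P :=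
      (integrable_const _).add ((integrable_const _).indicator hbm)
    calc _ ≤ ∫ o, (C ^ 2 * δ ^ 2 + bad.indicator (fun _ => 4 * C ^ 2) o) ∂P := by
          apply integral_mono_of_nonneg (Filter.Eventually.of_forall fun o => sq_nonneg _) hi
          filter_upwards [hPG] with o ho
          by_cases hb : o ∈ bad
          · have : o ∉ nice := fun h => h.2 hb
            simp only [this, if_false, hb, indicator_of_mem]
            have h1 := henvC o ho
            have h2 := henv0 o
            have : env o ^ 2 ≤ C ^ 2 := by gcongr
            nlinarith [sq_nonneg (C * δ)]
          · have : o ∈ nice := ⟨ho, hb⟩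
            simp only [this, if_true, hb, not_false_eq_true, indicator_of_notMem, add_zero]
            rw [mul_pow]
            have : (δ ^ 3) ^ 2 ≤ δ ^ 2 := by
              rw [← pow_mul]; exact pow_le_pow_of_le_one hδ0.le hδ1.le (by norm_num)
            gcongr
      _ = C ^ 2 * δ ^ 2 + P.real bad * (4 * C ^ 2) := by
          rw [integral_add (integrable_const _) ((integrable_const _).indicator hbm),
            integral_indicator hbm]
          simp
      _ ≤ _ := by
          have : P.real bad * (4 * C ^ 2) ≤ ((∫ o, t o ^ 2 ∂P) + 2 * D * (2 * C + 1)) * δ ^ 2 * (4 * C ^ 2) := by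
            gcongr
          linarith
  · intro θ hθ s hφ hs o i
    have hδ3 : 0 < δ ^ 3 := by positivity
    dsimp only
    by_cases hn : o ∈ nice
    · simp only [hn, if_true]
      obtain ⟨hoG, hob⟩ := hn
      simp only [hbad, mem_union, mem_ofPred_eq, not_or, not_le] at hob
      obtain ⟨hb1, hb2⟩ := hob
      have hT : |t o| < 1 / δ := by
        apply abs_lt_of_sq_lt_sq _ (by positivity)
        rw [div_pow, one_pow]; exact hb1
      have q1 := hed _ hδ3 θ hθ θ₀ hθ₀ hφ o hoG
      have q2 := heC θ hθ o hoG
      have q3 := hVd _ hδ3 θ hθ θ₀ hθ₀ hφ o hoG i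
      have q4 : |e θ o - e θ₀ o| + δ ^ 3 ≤ (2 * C + 1) * δ ^ 2 := by
        have : C * δ ^ 3 * (1 + |t o|) ≤ C * δ ^ 3 * (1 + 1 / δ) := by gcongr
        have e1 : C * δ ^ 3 * (1 + 1 / δ) = C * δ ^ 3 + C * δ ^ 2 := by field_simp
        have e2 : δ ^ 3 ≤ δ ^ 2 := pow_le_pow_of_le_one hδ0.le hδ1.le (by norm_num)
        have e3 : C * δ ^ 3 ≤ C * δ ^ 2 := by gcongr
        linarith
      have q5 : |e θ o| ≤ C * (1 + 1 / δ) := q2.trans (by gcongr)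
      have q6 : (s ≤ e θ o) ↔ (s₀ ≤ e θ₀ o) := by
        have r1 : (s ≤ e θ o) ↔ (max s (-(C * (1 + 1 / δ))) ≤ e θ o) := by
          rw [max_le_iff]
          exact ⟨fun h => ⟨h, (abs_le.1 q5).1⟩, fun h => h.1⟩
        rw [r1]
        set s' := max s (-(C * (1 + 1 / δ)))
        have w1 := abs_le.1 hs
        have w2 := abs_le.1 (le_refl |e θ o - e θ₀ o|)
        rcases lt_abs.1 hb2 with h | h
        · exact ⟨fun _ => by linarith [abs_nonneg (e θ o - e θ₀ o)], fun _ => by linarith⟩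
        · exact ⟨fun _ => by linarith, fun _ => by linarith [abs_nonneg (e θ o - e θ₀ o)]⟩
      simp only [q6]
      split_ifs
      · simpa using q3
      · simp; positivity
    · simp only [hn, if_false]
      have hx : ∀ (p : Prop) [Decidable p] (v : ℝ), |v| ≤ env o →
          |(if p then (1:ℝ) else 0) * v| ≤ env o := by
        intro p _ v hv
        split_ifs
        · simpa using hv
        · simpa using henv0 o
      have := abs_sub ((if s ≤ e θ o then (1:ℝ) else 0) * V θ o i)
        ((if s₀ ≤ e θ₀ o then (1:ℝ) else 0) * V θ₀ o i)
      have a1 := hx (s ≤ e θ o) _ (hVe θ hθ o i)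
      have a2 := hx (s₀ ≤ e θ₀ o) _ (hVe θ₀ hθ₀ o i)
      linarith

lemma aux_count {κ Par : Type*} [Fintype κ] (Θ : Set Par) (φ : Par → κ → ℝ)
    (R : ℝ) (hR : 0 ≤ R) (hφ : ∀ θ ∈ Θ, ∀ i, |φ θ i| ≤ R) (C : ℝ) (hC : 1 ≤ C) (τ : ℝ)
    (δ : ℝ) (hδ : δ ∈ Ioo (0:ℝ) 1) :
    ∃ (N : ℕ) (r : Fin N → Par × ℝ),
      (N : ℝ) ≤ ((4 * C + 2 * |τ| + 2) * (2 * R + 2) ^ Fintype.card κ) *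
        (1 / δ) ^ (3 * Fintype.card κ + 4) ∧
      (∀ k, (r k).1 ∈ Θ) ∧
      ∀ θ ∈ Θ, ∀ s ≤ τ, ∃ k, (∀ i, |φ θ i - φ (r k).1 i| ≤ δ ^ 3) ∧
        |max s (-(C * (1 + 1 / δ))) - (r k).2| ≤ δ ^ 3 := by
  obtain ⟨hδ0, hδ1⟩ := hδ
  set M := C * (1 + 1 / δ) with hM
  have hM0 : 0 ≤ M := by positivity
  obtain ⟨N, r, hN, hr, hc⟩ := aux_cover (X := Par × ℝ) (κ := Option κ)
    {y | y.1 ∈ Θ ∧ |y.2| ≤ M + |τ|} (fun y j => j.elim y.2 (φ y.1)) (fun j => j.elim (M + |τ|) (fun _ => R))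
    (δ ^ 3) (by positivity) (by
      rintro ⟨θ, s⟩ ⟨h1, h2⟩ (_ | i)
      · exact h2
      · exact hφ θ h1 i) (by
      rintro (_ | i)
      · exact add_nonneg hM0 (abs_nonneg _)
      · exact hR)
  refine ⟨N, r, hN.trans ?_, fun k => (hr k).1, ?_⟩
  · rw [Fintype.prod_option]
    simp only [Option.elim, Finset.prod_const, Finset.card_univ]
    have i1 : 1 ≤ 1 / δ := by rw [le_div_iff₀ hδ0]; linarith
    have e1 : 2 * (M + |τ|) / δ ^ 3 + 2 ≤ (4 * C + 2 * |τ| + 2) * (1 / δ) ^ 4 := by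
      have : 2 * (M + |τ|) / δ ^ 3 + 2 = (2 * C + 2 * |τ|) * (1 / δ) ^ 3 + 2 * C * (1 / δ) ^ 4 + 2 := by
        rw [hM]; field_simp; ring
      rw [this]
      have a1 : (1 / δ) ^ 3 ≤ (1 / δ) ^ 4 := pow_le_pow_right₀ i1 (by norm_num)
      have a2 : 1 ≤ (1 / δ) ^ 4 := one_le_pow₀ i1
      have : (2 * C + 2 * |τ|) * (1 / δ) ^ 3 ≤ (2 * C + 2 * |τ|) * (1 / δ) ^ 4 := by gcongr
      linarith
    have e2 : 2 * R / δ ^ 3 + 2 ≤ (2 * R + 2) * (1 / δ) ^ 3 := by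
      have : 2 * R / δ ^ 3 = 2 * R * (1 / δ) ^ 3 := by field_simp
      rw [this]
      have a2 : 1 ≤ (1 / δ) ^ 3 := one_le_pow₀ i1
      linarith
    calc _ ≤ ((4 * C + 2 * |τ| + 2) * (1 / δ) ^ 4) * ((2 * R + 2) * (1 / δ) ^ 3) ^ Fintype.card κ := by
          gcongr
      _ = _ := by rw [mul_pow, pow_add, pow_mul]; ring
  · intro θ hθ s hs
    obtain ⟨k, hk⟩ := hc (θ, max s (-M)) ⟨hθ, by
      refine abs_le.2 ⟨?_, max_le ?_ ?_⟩
      · linarith [le_max_right s (-M), abs_nonneg τ]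
      · linarith [le_abs_self τ]
      · linarith [abs_nonneg τ]⟩
    exact ⟨k, fun i => hk (some i), hk none⟩

lemma aux_sum_s1 {n : ℕ} (a b : Fin n → ℝ) (r s : ℝ) (hr : 0 ≤ r) (ha : ∀ i, |a i| ≤ r)
    (hb : ∀ i, |b i| ≤ s) : |∑ i, a i * b i| ≤ n * r * s := by
  calc _ ≤ ∑ i, |a i * b i| := Finset.abs_sum_le_sum_abs _ _
    _ ≤ ∑ i : Fin n, r * s := by
        apply Finset.sum_le_sum
        intro i _
        rw [abs_mul]
        exact mul_le_mul (ha i) (hb i) (abs_nonneg _) hr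
    _ = _ := by simp; ring

lemma aux_exp_s1 (a b L : ℝ) (ha : a ≤ L) (hb : b ≤ L) :
    |Real.exp a - Real.exp b| ≤ Real.exp L * |a - b| := by
  have key : ∀ a b : ℝ, b ≤ a → a ≤ L → |Real.exp a - Real.exp b| ≤ Real.exp L * |a - b| := by
    intro a b hab ha
    rw [abs_of_nonneg (sub_nonneg.2 (Real.exp_le_exp.2 hab)), abs_of_nonneg (sub_nonneg.2 hab)]
    have h1 : Real.exp b = Real.exp a * Real.exp (b - a) := by rw [← Real.exp_add]; ring_nf
    have h2 := Real.add_one_le_exp (b - a)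
    have h3 := Real.exp_pos a
    have h4 := Real.exp_le_exp.2 ha
    have : Real.exp a * (a - b) ≤ Real.exp L * (a - b) := by
      apply mul_le_mul_of_nonneg_right h4; linarith
    nlinarith
  rcases le_total b a with h | h
  · exact key a b h ha
  · rw [abs_sub_comm, abs_sub_comm a b]; exact key b a h hb


/-- Bracketing-number bound for the `ℝ^{p+q}`-valued class
`F₁ = { o ↦ 1{ε_θ(o) ≥ s} · (exp(γᵀz) xᵀ, zᵀ) : s ∈ (−∞,τ], θ ∈ Θ }`. -/
theorem stmt_1
    (p q : ℕ)
    (P : Measure (ℝ × EuclideanSpace ℝ (Fin p) × EuclideanSpace ℝ (Fin q)))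
    [IsProbabilityMeasure P]
    (Θ : Set (EuclideanSpace ℝ (Fin p) × EuclideanSpace ℝ (Fin q)))
    (hΘ : IsCompact Θ)
    (B : ℝ)
    (hB : ∀ᵐ o ∂P, ‖o.2.1‖ ≤ B ∧ ‖o.2.2‖ ≤ B)
    (hT : Integrable (fun o => o.1 ^ 2) P)
    (eps : (EuclideanSpace ℝ (Fin p) × EuclideanSpace ℝ (Fin q)) →
      (ℝ × EuclideanSpace ℝ (Fin p) × EuclideanSpace ℝ (Fin q)) → ℝ)
    (heps : ∀ θ o, eps θ o =
      Real.exp (∑ i, θ.2 i * o.2.2 i) * (o.1 + ∑ i, θ.1 i * o.2.1 i))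
    (D : ℝ)
    (hD : ∀ θ ∈ Θ, ∃ g : ℝ → ℝ, (∀ u, 0 ≤ g u ∧ g u ≤ D) ∧
      P.map (eps θ) = volume.withDensity (fun u => ENNReal.ofReal (g u)))
    (τ : ℝ)
    (F : (EuclideanSpace ℝ (Fin p) × EuclideanSpace ℝ (Fin q)) → ℝ →
      (ℝ × EuclideanSpace ℝ (Fin p) × EuclideanSpace ℝ (Fin q)) →
      EuclideanSpace ℝ (Fin p ⊕ Fin q))
    (hF : ∀ θ s o, F θ s o =
      fun i => (if s ≤ eps θ o then (1:ℝ) else 0) *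
        Sum.elim (fun i₁ => Real.exp (∑ j, θ.2 j * o.2.2 j) * o.2.1 i₁)
          (fun i₂ => o.2.2 i₂) i) :
    ∃ K₂ : ℝ, 0 < K₂ ∧ ∀ ε ∈ Ioo (0:ℝ) 1,
      ∃ (N : ℕ) (l u : Fin N →
        (ℝ × EuclideanSpace ℝ (Fin p) × EuclideanSpace ℝ (Fin q)) →
        EuclideanSpace ℝ (Fin p ⊕ Fin q)),
        (N : ℝ) ≤ K₂ * ε ^ (-(6 * (p : ℝ) + 7 * q + 9)) ∧
        (∀ k, Measurable (l k) ∧ Measurable (u k)) ∧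
        (∀ k o i, l k o i ≤ u k o i) ∧
        (∀ k, ∫ o, ‖u k o - l k o‖ ^ 2 ∂P ≤ ε ^ 2) ∧
        (∀ s ≤ τ, ∀ θ ∈ Θ, ∃ k, ∀ o i,
          l k o i ≤ F θ s o i ∧ F θ s o i ≤ u k o i) := by
  classical
  obtain ⟨R₀, hR₀⟩ := hΘ.isBounded.exists_norm_le
  set R := max R₀ 0 with hRdef
  have hR : 0 ≤ R := le_max_right _ _
  have hΘR : ∀ θ ∈ Θ, ‖θ‖ ≤ R := fun θ h => (hR₀ θ h).trans (le_max_left _ _)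
  have hβ : ∀ θ ∈ Θ, ∀ i, |θ.1 i| ≤ R := fun θ h i => by
    have h1 := PiLp.norm_apply_le θ.1 i
    exact h1.trans ((norm_fst_le θ).trans (hΘR θ h))
  have hγ : ∀ θ ∈ Θ, ∀ i, |θ.2 i| ≤ R := fun θ h i => by
    have h1 := PiLp.norm_apply_le θ.2 i
    exact h1.trans ((norm_snd_le θ).trans (hΘR θ h))
  set b := max B 0 with hbdef
  have hb0 : 0 ≤ b := le_max_right _ _
  set G : Set (ℝ × EuclideanSpace ℝ (Fin p) × EuclideanSpace ℝ (Fin q)) :=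
    {o | ‖o.2.1‖ ≤ b ∧ ‖o.2.2‖ ≤ b} with hGdef
  have hGm : MeasurableSet G := by
    exact (measurableSet_le (f := fun o : ℝ × EuclideanSpace ℝ (Fin p) × EuclideanSpace ℝ (Fin q) =>
      ‖o.2.1‖) (by fun_prop) measurable_const).inter
      (measurableSet_le (f := fun o : ℝ × EuclideanSpace ℝ (Fin p) × EuclideanSpace ℝ (Fin q) =>
      ‖o.2.2‖) (by fun_prop) measurable_const)
  have hPG : ∀ᵐ o ∂P, o ∈ G := by
    filter_upwards [hB] with o ho
    exact ⟨ho.1.trans (le_max_left _ _), ho.2.trans (le_max_left _ _)⟩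
  have hxi : ∀ (o : ℝ × EuclideanSpace ℝ (Fin p) × EuclideanSpace ℝ (Fin q)) i,
      |o.2.1 i| ≤ ‖o.2.1‖ := fun o i => PiLp.norm_apply_le o.2.1 i
  have hzi : ∀ (o : ℝ × EuclideanSpace ℝ (Fin p) × EuclideanSpace ℝ (Fin q)) i,
      |o.2.2 i| ≤ ‖o.2.2‖ := fun o i => PiLp.norm_apply_le o.2.2 i
  set E := Real.exp (q * R * b) with hE
  have hE0 : 0 < E := Real.exp_pos _
  let V : (EuclideanSpace ℝ (Fin p) × EuclideanSpace ℝ (Fin q)) →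
      (ℝ × EuclideanSpace ℝ (Fin p) × EuclideanSpace ℝ (Fin q)) → (Fin p ⊕ Fin q) → ℝ :=
    fun θ o => Sum.elim (fun i₁ => Real.exp (∑ j, θ.2 j * o.2.2 j) * o.2.1 i₁)
          (fun i₂ => o.2.2 i₂)
  let φ : (EuclideanSpace ℝ (Fin p) × EuclideanSpace ℝ (Fin q)) → (Fin p ⊕ Fin q) → ℝ :=
    fun θ => Sum.elim (fun i => θ.1 i) (fun i => θ.2 i)
  let env : (ℝ × EuclideanSpace ℝ (Fin p) × EuclideanSpace ℝ (Fin q)) → ℝ :=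
    fun o => Real.exp (q * R * ‖o.2.2‖) * ‖o.2.1‖ + ‖o.2.2‖
  obtain ⟨C, hC1, hC2, hC3, hC4, hC5⟩ : ∃ C : ℝ, 1 ≤ C ∧ E * b + b ≤ C ∧ E * (1 + p * R * b) ≤ C ∧
      E * (q * b * (1 + p * R * b) + p * b) ≤ C ∧ E * q * b * b ≤ C := by
    have h1 : 0 ≤ E * b + b := by positivity
    have h2 : 0 ≤ E * (1 + p * R * b) := by positivity
    have h3 : 0 ≤ E * (q * b * (1 + p * R * b) + p * b) := by positivity
    have h4 : 0 ≤ E * q * b * b := by positivity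
    refine ⟨1 + (E * b + b) + E * (1 + p * R * b) + E * (q * b * (1 + p * R * b) + p * b)
      + E * q * b * b, ?_, ?_, ?_, ?_, ?_⟩ <;> linarith
  have hepsm : ∀ θ, Measurable (eps θ) := by
    intro θ
    have : eps θ = fun o => Real.exp (∑ i, θ.2 i * o.2.2 i) * (o.1 + ∑ i, θ.1 i * o.2.1 i) :=
      funext (heps θ)
    rw [this]
    fun_prop
  have hVm : ∀ θ i, Measurable (fun o => V θ o i) := by
    rintro θ (i | i)
    · simp only [V, Sum.elim_inl]; fun_prop
    · simp only [V, Sum.elim_inr]; fun_prop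
  have hgz : ∀ θ ∈ Θ, ∀ o ∈ G, |∑ j, θ.2 j * o.2.2 j| ≤ q * R * b := fun θ h o ho =>
    aux_sum_s1 _ _ R b hR (hγ θ h) (fun i => (hzi o i).trans ho.2)
  have hbx : ∀ θ ∈ Θ, ∀ o ∈ G, |∑ j, θ.1 j * o.2.1 j| ≤ p * R * b := fun θ h o ho =>
    aux_sum_s1 _ _ R b hR (hβ θ h) (fun i => (hxi o i).trans ho.1)
  have hexpE : ∀ θ ∈ Θ, ∀ o ∈ G, Real.exp (∑ j, θ.2 j * o.2.2 j) ≤ E := fun θ h o ho =>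
    Real.exp_le_exp.2 ((abs_le.1 (hgz θ h o ho)).2)
  have hlin : ∀ θ ∈ Θ, ∀ o ∈ G, |o.1 + ∑ j, θ.1 j * o.2.1 j| ≤ (1 + p * R * b) * (1 + |o.1|) := by
    intro θ h o ho
    have h1 := abs_add_le o.1 (∑ j, θ.1 j * o.2.1 j)
    have h2 := hbx θ h o ho
    have h3 : 0 ≤ p * R * b * |o.1| := by positivity
    linarith
  have hexpd : ∀ η > 0, ∀ θ ∈ Θ, ∀ θ' ∈ Θ, (∀ i, |φ θ i - φ θ' i| ≤ η) →
      ∀ o ∈ G, |Real.exp (∑ j, θ.2 j * o.2.2 j) - Real.exp (∑ j, θ'.2 j * o.2.2 j)|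
        ≤ E * (q * η * b) := by
    intro η hη θ h θ' h' hd o ho
    refine (aux_exp_s1 _ _ (q * R * b) ((abs_le.1 (hgz θ h o ho)).2)
      ((abs_le.1 (hgz θ' h' o ho)).2)).trans ?_
    gcongr
    rw [← Finset.sum_sub_distrib]
    simp only [← sub_mul]
    exact aux_sum_s1 _ _ η b hη.le (fun i => hd (Sum.inr i)) (fun i => (hzi o i).trans ho.2)
  have hmain := aux_bracket_s1 P Θ φ (fun o => o.1) measurable_fst hT eps hepsm V hVm G hGm hPG env
    (by simp only [env]; fun_prop)
    (by
      rintro θ h o (i | i)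
      · simp only [V, Sum.elim_inl, env]
        rw [abs_mul, abs_of_pos (Real.exp_pos _)]
        have h1 : Real.exp (∑ j, θ.2 j * o.2.2 j) ≤ Real.exp (q * R * ‖o.2.2‖) :=
          Real.exp_le_exp.2 (abs_le.1 (aux_sum_s1 _ _ R _ hR (hγ θ h) (hzi o))).2
        have h2 : Real.exp (∑ j, θ.2 j * o.2.2 j) * |o.2.1 i|
          ≤ Real.exp (q * R * ‖o.2.2‖) * ‖o.2.1‖ := by
          gcongr
          exact hxi o i
        linarith [norm_nonneg o.2.2]
      · simp only [V, Sum.elim_inr, env]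
        have : 0 ≤ Real.exp (q * R * ‖o.2.2‖) * ‖o.2.1‖ := by positivity
        linarith [hzi o i])
    (fun o => by simp only [env]; positivity)
    C hC1
    (by
      intro o ho
      refine le_trans ?_ hC2
      simp only [env, hE]
      have h1 := ho.1
      have h2 := ho.2
      gcongr)
    (by
      intro θ h o ho
      rw [heps, abs_mul, abs_of_pos (Real.exp_pos _)]
      calc _ ≤ E * ((1 + p * R * b) * (1 + |o.1|)) := by
            gcongr
            · exact hexpE θ h o ho
            · exact hlin θ h o ho
        _ = (E * (1 + p * R * b)) * (1 + |o.1|) := by ring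
        _ ≤ _ := by gcongr)
    (by
      intro η hη θ h θ' h' hd o ho
      have h1 := hexpd η hη θ h θ' h' hd o ho
      have h2 := hlin θ h o ho
      have h3 := hexpE θ' h' o ho
      have h4 : |(∑ j, θ.1 j * o.2.1 j) - ∑ j, θ'.1 j * o.2.1 j| ≤ p * η * b := by
        rw [← Finset.sum_sub_distrib]
        simp only [← sub_mul]
        exact aux_sum_s1 _ _ η b hη.le (fun i => hd (Sum.inl i)) (fun i => (hxi o i).trans ho.1)
      rw [heps, heps]
      set e1 := Real.exp (∑ j, θ.2 j * o.2.2 j)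
      set e2 := Real.exp (∑ j, θ'.2 j * o.2.2 j) with he2
      have he2p : 0 < e2 := Real.exp_pos _
      set a1 := ∑ j, θ.1 j * o.2.1 j
      set a2 := ∑ j, θ'.1 j * o.2.1 j
      calc |e1 * (o.1 + a1) - e2 * (o.1 + a2)| = |(e1 - e2) * (o.1 + a1) + e2 * (a1 - a2)| := by
            congr 1; ring
        _ ≤ |e1 - e2| * |o.1 + a1| + e2 * |a1 - a2| := by
            refine (abs_add_le _ _).trans ?_
            rw [abs_mul, abs_mul, abs_of_pos he2p]
        _ ≤ E * (q * η * b) * ((1 + p * R * b) * (1 + |o.1|)) + E * (p * η * b) := by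
            gcongr
        _ ≤ E * (q * η * b) * ((1 + p * R * b) * (1 + |o.1|)) + E * (p * η * b) * (1 + |o.1|) := by
            have : 0 ≤ E * (p * η * b) * |o.1| := by positivity
            linarith
        _ = (E * (q * b * (1 + p * R * b) + p * b)) * η * (1 + |o.1|) := by ring
        _ ≤ _ := by gcongr)
    (by
      rintro η hη θ h θ' h' hd o ho (i | i)
      · simp only [V, Sum.elim_inl]
        rw [← sub_mul, abs_mul]
        calc _ ≤ E * (q * η * b) * b := by
              gcongr
              · exact hexpd η hη θ h θ' h' hd o ho
              · exact (hxi o i).trans ho.1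
          _ = (E * q * b * b) * η := by ring
          _ ≤ _ := by gcongr
      · simp only [V, Sum.elim_inr, sub_self, abs_zero]
        positivity)
    D
    (by
      intro θ h s r hr
      obtain ⟨g, hg, hmap⟩ := hD θ h
      have hD0 : 0 ≤ D := (hg 0).1.trans (hg 0).2
      have hset : {o | |eps θ o - s| ≤ r} = eps θ ⁻¹' (Icc (s - r) (s + r)) := by
        ext o
        simp only [mem_ofPred_eq, mem_preimage, mem_Icc, abs_le]
        constructor <;> rintro ⟨h1, h2⟩ <;> constructor <;> linarith
      have hle : P {o | |eps θ o - s| ≤ r} ≤ ENNReal.ofReal (2 * D * r) := by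
        rw [hset, ← Measure.map_apply (hepsm θ) measurableSet_Icc, hmap,
          withDensity_apply _ measurableSet_Icc]
        calc _ ≤ ∫⁻ _ in Icc (s - r) (s + r), ENNReal.ofReal D :=
              lintegral_mono (fun u => ENNReal.ofReal_le_ofReal (hg u).2)
          _ = ENNReal.ofReal D * ENNReal.ofReal (2 * r) := by
              rw [setLIntegral_const, Real.volume_Icc]; congr 2; ring
          _ = _ := by rw [← ENNReal.ofReal_mul hD0]; congr 1; ring
      exact ENNReal.toReal_le_of_le_ofReal (by positivity) hle)
  set A := C^2 + 4 * C^2 * ((∫ o, o.1 ^ 2 ∂P) + 2 * D * (2 * C + 1)) with hA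
  set A' := 1 + 4 * ((p:ℝ) + q) * |A| with hA'
  have hA1 : 1 ≤ A' := by
    have : 0 ≤ 4 * ((p:ℝ) + q) * |A| := by positivity
    linarith
  have hA0 : 0 < A' := by linarith
  set n := 3 * (p + q) + 4 with hn
  set K := ((4 * C + 2 * |τ| + 2) * (2 * R + 2) ^ (p + q)) with hK
  have hK0 : 0 < K := by positivity
  refine ⟨K * A' ^ n, by positivity, ?_⟩
  rintro ε ⟨hε0, hε1⟩
  have hδ : ε / A' ∈ Ioo (0:ℝ) 1 := by
    refine ⟨by positivity, ?_⟩
    rw [div_lt_one hA0]; linarith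
  obtain ⟨N, r, hN, hrΘ, hr⟩ := aux_count Θ φ R hR
    (by
      rintro θ h (i | i)
      · exact hβ θ h i
      · exact hγ θ h i) C hC1 τ (ε / A') hδ
  choose c h hcm hhm hh0 hint hcov using fun k => hmain (ε / A') hδ (r k).1 (hrΘ k) (r k).2
  refine ⟨N, fun k o => WithLp.toLp 2 (fun i => c k o i - h k o),
    fun k o => WithLp.toLp 2 (fun i => c k o i + h k o), ?_, ?_, ?_, ?_, ?_⟩
  · refine hN.trans ?_
    simp only [Fintype.card_sum, Fintype.card_fin]
    rw [← hK, ← hn, one_div_div, div_pow, mul_assoc K]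
    refine mul_le_mul_of_nonneg_left ?_ hK0.le
    rw [div_eq_mul_inv]
    refine mul_le_mul_of_nonneg_left ?_ (by positivity)
    rw [← Real.rpow_natCast, ← Real.rpow_neg hε0.le]
    apply Real.rpow_le_rpow_of_exponent_ge hε0 hε1.le
    rw [hn]
    push_cast
    have : (0:ℝ) ≤ p := by positivity
    have : (0:ℝ) ≤ q := by positivity
    linarith
  · intro k
    constructor
    · exact (WithLp.measurable_toLp 2 _).comp
        (measurable_pi_iff.2 fun i => (hcm k i).sub (hhm k))
    · exact (WithLp.measurable_toLp 2 _).comp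
        (measurable_pi_iff.2 fun i => (hcm k i).add (hhm k))
  · intro k o i
    have := hh0 k o
    simp only
    linarith
  · intro k
    have : ∀ o, ‖(WithLp.toLp 2 (fun i => c k o i + h k o) : EuclideanSpace ℝ (Fin p ⊕ Fin q)) -
        WithLp.toLp 2 (fun i => c k o i - h k o)‖ ^ 2 = (4 * ((p:ℝ) + q)) * h k o ^ 2 := by
      intro o
      rw [EuclideanSpace.real_norm_sq_eq]
      have : ∀ i, (c k o i + h k o - (c k o i - h k o)) ^ 2 = 4 * h k o ^ 2 := fun i => by ring
      simp [this]
      ring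
    simp only [this]
    rw [integral_const_mul]
    have h1 : ∫ o, h k o ^ 2 ∂P ≤ |A| * (ε / A') ^ 2 := (hint k).trans (by
      gcongr
      exact le_abs_self A)
    calc _ ≤ 4 * ((p:ℝ) + q) * (|A| * (ε / A') ^ 2) := by gcongr
      _ = (A' - 1) / A' ^ 2 * ε ^ 2 := by
          have : 4 * ((p:ℝ) + q) * |A| = A' - 1 := by rw [hA']; ring
          rw [← this, div_pow]; ring
      _ ≤ 1 * ε ^ 2 := by
          gcongr
          rw [div_le_one (by positivity)]
          nlinarith
      _ = _ := one_mul _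
  · intro s hs θ hθ
    obtain ⟨k, hk1, hk2⟩ := hr θ hθ s hs
    refine ⟨k, fun o i => ?_⟩
    have h1 := abs_le.1 (hcov k θ hθ s hk1 hk2 o i)
    have h2 : F θ s o i = (if s ≤ eps θ o then (1:ℝ) else 0) * V θ o i := congrFun (hF θ s o) i
    rw [h2]
    simp only
    constructor <;> linarith
end

section
/- Let (Ω, 𝔽, P) be a probability space, let f be a real-valued random variable whose law is absolutely continuous with respect to Lebesgue measure with density bounded by a constant D < ∞, and let m be a nonnegative random variable with E[m²] < ∞. Then for every ε ∈ (0,1] and every t ∈ ℝ, P(|f − t| ≤ ε(m + 1)) ≤ (E[m²] + 2D) ε^{2/3} + 2D ε. -/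
open MeasureTheory Set

/-- Quantitative bound `P(|f − t| ≤ ε(m + 1)) ≤ (E[m²] + 2D) ε^{2/3} + 2D ε`
for a random variable `f` with bounded density and `m ≥ 0` square integrable. -/
theorem stmt_6
    {Ω : Type*} [MeasurableSpace Ω] (μ : Measure Ω) [IsProbabilityMeasure μ]
    (f m : Ω → ℝ) (hf : Measurable f) (hm : Measurable m)
    (hm0 : ∀ ω, 0 ≤ m ω)
    (hm2 : Integrable (fun ω => m ω ^ 2) μ)
    (D : ℝ) (g : ℝ → ℝ) (hg : ∀ u, 0 ≤ g u ∧ g u ≤ D)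
    (hlaw : μ.map f = volume.withDensity fun u => ENNReal.ofReal (g u))
    (ε : ℝ) (hε : ε ∈ Ioc (0:ℝ) 1) (t : ℝ) :
    (μ {ω | |f ω - t| ≤ ε * (m ω + 1)}).toReal ≤
      ((∫ ω, m ω ^ 2 ∂μ) + 2 * D) * ε ^ ((2:ℝ) / 3) + 2 * D * ε := by
  obtain ⟨hε0, hε1⟩ := hε
  have hD : 0 ≤ D := (hg 0).1.trans (hg 0).2
  obtain ⟨s, hs0, hs3, hs2⟩ : ∃ s : ℝ, 0 < s ∧ ε = s ^ 3 ∧ ε ^ ((2:ℝ) / 3) = s ^ 2 := by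
    refine ⟨ε ^ ((1:ℝ) / 3), by positivity, ?_, ?_⟩
    · rw [← Real.rpow_natCast, ← Real.rpow_mul hε0.le]; norm_num
    · rw [← Real.rpow_natCast, ← Real.rpow_mul hε0.le]; norm_num
  rw [hs2]
  have hA : μ.real {ω | (s⁻¹) ^ 2 ≤ m ω ^ 2} ≤ (∫ ω, m ω ^ 2 ∂μ) * s ^ 2 := by
    have h := mul_meas_ge_le_integral_of_nonneg (μ := μ)
      (Filter.Eventually.of_forall fun ω => sq_nonneg (m ω)) hm2 ((s⁻¹) ^ 2)
    calc _ = ((s⁻¹) ^ 2 * μ.real {ω | (s⁻¹) ^ 2 ≤ m ω ^ 2}) * s ^ 2 := by field_simp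
      _ ≤ _ := by gcongr
  have hB : μ.real (f ⁻¹' Icc (t - (s ^ 2 + ε)) (t + (s ^ 2 + ε))) ≤ 2 * D * (s ^ 2 + ε) := by
    rw [Measure.real, ← Measure.map_apply hf measurableSet_Icc, hlaw,
      withDensity_apply _ measurableSet_Icc]
    refine ENNReal.toReal_le_of_le_ofReal (by positivity) ?_
    calc _ ≤ ∫⁻ u in Icc (t - (s ^ 2 + ε)) (t + (s ^ 2 + ε)), ENNReal.ofReal D :=
          lintegral_mono fun u => ENNReal.ofReal_le_ofReal (hg u).2
      _ = _ := by
          rw [setLIntegral_const, Real.volume_Icc, ← ENNReal.ofReal_mul hD]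
          congr 1; ring
  have hsub : {ω | |f ω - t| ≤ ε * (m ω + 1)} ⊆
      {ω | (s⁻¹) ^ 2 ≤ m ω ^ 2} ∪ f ⁻¹' Icc (t - (s ^ 2 + ε)) (t + (s ^ 2 + ε)) := by
    intro ω hω
    rcases le_total (s⁻¹) (m ω) with h | h
    · left
      exact pow_le_pow_left₀ (by positivity) h 2
    · right
      have h1 : ε * (m ω + 1) ≤ s ^ 2 + ε := by
        have h2 : ε * m ω ≤ ε * s⁻¹ := by gcongr
        have h3 : ε * s⁻¹ = s ^ 2 := by rw [hs3]; field_simp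
        linarith
      have h4 := abs_le.1 (le_trans hω h1)
      constructor <;> linarith [h4.1, h4.2]
  have h := (measureReal_mono (μ := μ) hsub).trans (measureReal_union_le _ _)
  change μ.real _ ≤ _
  linarith
end

section
/- Let Q₀ : (0,1) → (0, ∞) be continuous and strictly increasing with Q₀(π) → 0 as π → 0⁺ and Q₀(π) → ∞ as π → 1⁻. Let β ∈ ℝ^p, γ ∈ ℝ^q, and covariate vectors x_i, x_j ∈ ℝ^p, z_i, z_j ∈ ℝ^q with γᵀ(z_j − z_i) ≠ 0. Then there exists π ∈ (0,1) such that the quantile ratio r(π) = exp(−βᵀ(x_j − x_i)) · Q₀(π)^{exp(−γᵀz_j) − exp(−γᵀz_i)} equals 1; that is, the quantile functions (and hence the survivor functions) of the two individuals cross. -/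
open Set Filter

/-- Crossing of quantile (hence survivor) functions: if `γᵀ(z_j − z_i) ≠ 0`
then the quantile ratio equals one at some `π ∈ (0,1)`. -/
theorem stmt_14
    (p q : ℕ) (Q₀ : ℝ → ℝ)
    (hcont : ContinuousOn Q₀ (Ioo (0:ℝ) 1))
    (hmono : StrictMonoOn Q₀ (Ioo (0:ℝ) 1))
    (hpos : ∀ u ∈ Ioo (0:ℝ) 1, 0 < Q₀ u)
    (h0 : Tendsto Q₀ (nhdsWithin 0 (Ioi (0:ℝ))) (nhds 0))
    (h1 : Tendsto Q₀ (nhdsWithin 1 (Iio (1:ℝ))) atTop)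
    (β : EuclideanSpace ℝ (Fin p)) (γ : EuclideanSpace ℝ (Fin q))
    (xi xj : EuclideanSpace ℝ (Fin p)) (zi zj : EuclideanSpace ℝ (Fin q))
    (hne : (∑ i, γ i * (zj i - zi i)) ≠ 0)
    (r : ℝ → ℝ)
    (hr : ∀ u, r u = Real.exp (-∑ i, β i * (xj i - xi i)) *
      Q₀ u ^ (Real.exp (-∑ i, γ i * zj i) - Real.exp (-∑ i, γ i * zi i))) :
    ∃ u ∈ Ioo (0:ℝ) 1, r u = 1 := by
  set b := ∑ i, β i * (xj i - xi i) with hb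
  set d := Real.exp (-∑ i, γ i * zj i) - Real.exp (-∑ i, γ i * zi i) with hd
  have hd0 : d ≠ 0 := by
    intro h
    apply hne
    have h2 := Real.exp_injective (sub_eq_zero.mp h)
    simp only [mul_sub, Finset.sum_sub_distrib]
    linarith
  have ht : 0 < Real.exp (b / d) := Real.exp_pos _
  have e0 : ∀ᶠ u in nhdsWithin 0 (Ioi (0:ℝ)), u ∈ Ioo (0:ℝ) 1 :=
    Ioo_mem_nhdsGT one_pos
  have e1 : ∀ᶠ u in nhdsWithin 1 (Iio (1:ℝ)), u ∈ Ioo (0:ℝ) 1 :=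
    Ioo_mem_nhdsLT one_pos
  obtain ⟨a, ha, ha'⟩ := (e0.and (h0.eventually_lt_const ht)).exists
  obtain ⟨c, hc, hc'⟩ := (e1.and (h1.eventually_ge_atTop (Real.exp (b / d)))).exists
  obtain ⟨u, hu, hut⟩ := isPreconnected_Ioo.intermediate_value ha hc hcont ⟨ha'.le, hc'⟩
  refine ⟨u, hu, ?_⟩
  rw [hr, hut, ← Real.exp_mul, div_mul_cancel₀ _ hd0, ← Real.exp_add]
  simp
end
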